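/- Let n ≥ m ≥ 1, let U ⊆ ℝⁿ be open, and let F : U → ℝ^m be a smooth (C^∞) map such that 0 ∈ ℝ^m is a regular value of F, i.e., the Fréchet derivative dF_x is surjective at every x ∈ F^{−1}(0). Then for every continuous function f : U → ℝ with compact support contained in U, there exists a real number L such that for every continuous φ : ℝ^m → [0,∞) with compact support and ∫_{ℝ^m} φ(y) dy = 1, one has lim_{ε→0⁺} ∫_U f(x) ε^{−m} φ(F(x)/ε) dx = L. (The limit exists and is independent of the choice of approximate identity φ_ε(y) = ε^{−m}φ(y/ε); the resulting functional f ↦ L defines the Leray measure on F^{−1}(0).) -/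

import Mathlib

open MeasureTheory ENNReal NNReal

noncomputable section

open Module Filter Topology Set

variable {E G : Type*} [NormedAddCommGroup E] [NormedSpace ℝ E] [FiniteDimensional ℝ E]
  [MeasurableSpace E] [BorelSpace E] [NormedAddCommGroup G] [NormedSpace ℝ G]
  [FiniteDimensional ℝ G] [MeasurableSpace G] [BorelSpace G]

/-- `L` is the limit of `∫_U f(x) ε^{-dim G} φ(F(x)/ε) dx` as `ε → 0⁺`, for every compactly
supported continuous probability density `φ`. -/
def IsLerayLimit (μ : Measure E) (ν : Measure G) (U : Set E) (F : E → G) (f : E → ℝ) (L : ℝ) :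
    Prop :=
  ∀ φ : G → ℝ, Continuous φ → HasCompactSupport φ → (∀ y, 0 ≤ φ y) → (∫ y, φ y ∂ν) = 1 →
    Tendsto (fun ε : ℝ => ∫ x in U, f x * ((ε ^ finrank ℝ G)⁻¹ * φ (ε⁻¹ • F x)) ∂μ)
      (𝓝[>] 0) (𝓝 L)

theorem exists_isLerayLimit_clm (μ : Measure E) [μ.IsAddHaarMeasure] (ν : Measure G)
    [ν.IsAddHaarMeasure] (A : E →L[ℝ] G) (hA : Function.Surjective A) {h : E → ℝ}
    (hh : Continuous h) (hhc : HasCompactSupport h) :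
    ∃ L, IsLerayLimit μ ν univ A h L := by
  obtain ⟨S, hS⟩ := A.exists_rightInverse_of_surjective (LinearMap.range_eq_top.2 hA)
  let T := ContinuousLinearEquiv.equivOfRightInverse A S fun y => DFunLike.congr_fun hS y
  let κ : Measure (A : E →ₗ[ℝ] G).ker := Measure.addHaar
  have := T.isAddHaarMeasure_map μ
  set c := Measure.addHaarScalarFactor (μ.map T) (ν.prod κ)
  have hc : μ.map T = c • ν.prod κ := Measure.isAddLeftInvariant_eq_smul _ _
  have hk : Continuous fun p => h (T.symm p) := hh.comp T.symm.continuous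
  have hkc : HasCompactSupport fun p => h (T.symm p) :=
    hhc.comp_homeomorph T.symm.toHomeomorph
  let H : G → ℝ := fun y => ∫ k, h (T.symm (y, k)) ∂κ
  have hH : Continuous H := by
    rw [← continuousOn_univ]
    refine continuousOn_integral_of_compact_support (k := Prod.snd '' tsupport fun p => h (T.symm p))
      (hkc.isCompact.image continuous_snd) hk.continuousOn fun y k _ hyk => ?_
    by_contra h0
    exact hyk ⟨(y, k), subset_tsupport _ h0, rfl⟩
  have hHi : Integrable H ν := (hk.integrable_of_hasCompactSupport hkc).integral_prod_left
  refine ⟨c * H 0, fun φ hφ hφc hφ0 hφ1 => ?_⟩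
  have hdecay : Tendsto (fun x => ‖x‖ ^ finrank ℝ G * φ x) (Bornology.cobounded G) (𝓝 0) := by
    refine tendsto_const_nhds.congr' ?_
    have : ∀ᶠ x in Bornology.cobounded G, φ x = 0 := by
      filter_upwards [Bornology.isBounded_def.1 hφc.isCompact.isBounded] with x hx
      exact image_eq_zero_of_notMem_tsupport hx
    filter_upwards [this] with x hx
    simp [hx]
  have key := ((tendsto_integral_comp_smul_smul_of_integrable hφ0 hφ1 hdecay hHi
    hH.continuousAt).comp tendsto_inv_nhdsGT_zero).const_mul (c : ℝ)
  refine key.congr fun ε => ?_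
  have e1 : ∫ x, h x * ((ε ^ finrank ℝ G)⁻¹ * φ (ε⁻¹ • A x)) ∂μ =
      ∫ p, h (T.symm p) * ((ε ^ finrank ℝ G)⁻¹ * φ (ε⁻¹ • p.1)) ∂(μ.map T) := by
    refine Eq.trans ?_ (T.toHomeomorph.measurableEmbedding.integral_map _).symm
    refine integral_congr_ae (.of_forall fun x => ?_)
    have : (T x).1 = A x := ContinuousLinearEquiv.fst_equivOfRightInverse A S _ x
    simp [this]
  rw [setIntegral_univ, e1, hc, integral_smul_nnreal_measure, integral_prod, NNReal.smul_def,
    smul_eq_mul]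
  · simp only [integral_mul_const, Function.comp, inv_pow, smul_eq_mul, mul_comm _ (H _)]
    rfl
  · refine Continuous.integrable_of_hasCompactSupport ?_ hkc.mul_right
    exact hk.mul (continuous_const.mul (hφ.comp (continuous_const.smul continuous_fst)))

theorem exists_isOpen_isLerayLimit_of_eq_zero (μ : Measure E) [μ.IsAddHaarMeasure] (ν : Measure G)
    [ν.IsAddHaarMeasure] {U : Set E} (hU : IsOpen U) {F : E → G} (hF : ContDiffOn ℝ 1 F U)
    {a : E} (ha : a ∈ U) (hA : Function.Surjective (fderiv ℝ F a)) :
    ∃ V, IsOpen V ∧ a ∈ V ∧ V ⊆ U ∧ ∀ g : E → ℝ, Continuous g → HasCompactSupport g →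
      tsupport g ⊆ V → ∃ L, IsLerayLimit μ ν U F g L := by
  set A := fderiv ℝ F a
  obtain ⟨S, hS⟩ := A.exists_rightInverse_of_surjective (LinearMap.range_eq_top.2 hA)
  have hAS : ∀ y, A (S y) = y := fun y => DFunLike.congr_fun hS y
  let Θ : E → E := fun x => x + S (F x - A x)
  let Θ' : E → E →L[ℝ] E := fun x => .id ℝ E + S.comp (fderiv ℝ F x - A)
  have hAΘ : ∀ x, A (Θ x) = F x := fun x => by simp [Θ, hAS]
  have hΘ : ∀ x ∈ U, HasFDerivAt Θ (Θ' x) x := fun x hx =>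
    (hasFDerivAt_id x).add (S.hasFDerivAt.comp x
      ((((hF.contDiffAt (hU.mem_nhds hx)).differentiableAt one_ne_zero).hasFDerivAt).sub
        A.hasFDerivAt))
  have hΘa : HasStrictFDerivAt Θ ((ContinuousLinearEquiv.refl ℝ E : E ≃L[ℝ] E) : E →L[ℝ] E) a := by
    have h1 : ContDiffAt ℝ 1 Θ a := contDiffAt_id.add
      (S.contDiff.contDiffAt.comp a ((hF.contDiffAt (hU.mem_nhds ha)).sub A.contDiff.contDiffAt))
    have h2 := h1.hasStrictFDerivAt' (hΘ a ha) one_ne_zero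
    convert h2 using 1
    ext x
    simp [Θ', A]
  let e := hΘa.toOpenPartialHomeomorph Θ
  have hdet : ContinuousOn (fun x => (Θ' x).det) U := by
    refine ContinuousLinearMap.continuous_det.comp_continuousOn ?_
    exact continuousOn_const.add (continuousOn_const.clm_comp
      ((hF.continuousOn_fderiv_of_isOpen hU le_rfl).sub continuousOn_const))
  let V := e.source ∩ (U ∩ (fun x => (Θ' x).det) ⁻¹' {0}ᶜ)
  have hV : IsOpen V :=
    e.open_source.inter (hdet.isOpen_inter_preimage hU isOpen_compl_singleton)
  have hVU : V ⊆ U := fun x hx => hx.2.1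
  refine ⟨V, hV, ⟨hΘa.mem_toOpenPartialHomeomorph_source, ha, ?_⟩, hVU, fun g hg hgc hgV => ?_⟩
  · simp [Θ', A, ContinuousLinearMap.det]
  have hinj : InjOn Θ V := e.injOn.mono inter_subset_left
  have hW : IsOpen (Θ '' V) := e.isOpen_image_of_subset_source hV inter_subset_left
  let q : E → ℝ := fun x => g x / |(Θ' x).det|
  have hq : ContinuousOn q V :=
    hg.continuousOn.div (hdet.mono hVU).abs fun x hx => abs_ne_zero.2 hx.2.2
  let h : E → ℝ := (Θ '' V).indicator (q ∘ e.symm)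
  have hleft : ∀ x ∈ V, e.symm (Θ x) = x := fun x hx => e.left_inv hx.1
  have hhΘ : ∀ x ∈ V, h (Θ x) = q x := fun x hx => by
    simp [h, indicator_of_mem (mem_image_of_mem Θ hx), hleft x hx]
  have hΘc : ContinuousOn Θ U := fun x hx => (hΘ x hx).continuousAt.continuousWithinAt
  have hcpt : IsCompact (Θ '' tsupport g) :=
    hgc.isCompact.image_of_continuousOn (hΘc.mono (hgV.trans hVU))
  have hsupp : Function.support h ⊆ Θ '' tsupport g := by
    intro z hz
    have hzV : z ∈ Θ '' V := by
      by_contra h0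
      exact hz (indicator_of_notMem h0 _)
    obtain ⟨x, hx, rfl⟩ := hzV
    refine ⟨x, subset_tsupport _ fun h0 => hz ?_, rfl⟩
    simp [hhΘ x hx, q, h0]
  have hts : tsupport h ⊆ Θ '' tsupport g := closure_minimal hsupp hcpt.isClosed
  have hhc : HasCompactSupport h := hcpt.of_isClosed_subset (isClosed_tsupport _) hts
  have hh : Continuous h := by
    refine ContinuousOn.continuous_of_tsupport_subset ?_ hW (hts.trans (image_mono hgV))
    refine ContinuousOn.congr (f := q ∘ e.symm) ?_ fun z hz => indicator_of_mem hz _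
    refine hq.comp (e.continuousOn_symm.mono ?_) ?_
    · rintro _ ⟨x, hx, rfl⟩
      exact e.map_source hx.1
    · rintro _ ⟨x, hx, rfl⟩
      rwa [hleft x hx]
  obtain ⟨L, hL⟩ := exists_isLerayLimit_clm μ ν A hA hh hhc
  refine ⟨L, fun φ hφ hφc hφ0 hφ1 => (hL φ hφ hφc hφ0 hφ1).congr fun ε => ?_⟩
  rw [setIntegral_eq_of_subset_of_forall_sdiff_eq_zero MeasurableSet.univ (subset_univ (Θ '' V)),
    integral_image_eq_integral_abs_det_fderiv_smul μ hV.measurableSet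
      (fun x hx => (hΘ x (hVU hx)).hasFDerivWithinAt) hinj,
    setIntegral_eq_of_subset_of_forall_sdiff_eq_zero hU.measurableSet hVU]
  · refine setIntegral_congr_fun hV.measurableSet fun x hx => ?_
    have : |(Θ' x).det| ≠ 0 := abs_ne_zero.2 hx.2.2
    simp only [hhΘ x hx, hAΘ, smul_eq_mul, q]
    field_simp
  · intro x hx
    rw [image_eq_zero_of_notMem_tsupport fun h0 => hx.2 (hgV h0), zero_mul]
  · intro z hz
    rw [show h z = 0 from indicator_of_notMem hz.2 _, zero_mul]

omit [NormedSpace ℝ E] [FiniteDimensional ℝ E] [BorelSpace E] [FiniteDimensional ℝ G]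
  [BorelSpace G] in
theorem exists_isOpen_isLerayLimit_of_ne_zero (μ : Measure E) (ν : Measure G) {U : Set E}
    (hU : IsOpen U) {F : E → G} (hF : ContinuousOn F U) {a : E} (ha : a ∈ U) (hFa : F a ≠ 0) :
    ∃ V, IsOpen V ∧ a ∈ V ∧ V ⊆ U ∧ ∀ g : E → ℝ, tsupport g ⊆ V →
      IsLerayLimit μ ν U F g 0 := by
  have ha0 : 0 < ‖F a‖ := norm_pos_iff.2 hFa
  refine ⟨U ∩ (fun x => ‖F x‖) ⁻¹' Ioi (‖F a‖ / 2), hF.norm.isOpen_inter_preimage hU isOpen_Ioi,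
    ⟨ha, half_lt_self ha0⟩, inter_subset_left, fun g hg φ hφ hφc hφ0 hφ1 => ?_⟩
  obtain ⟨R, hR0, hR⟩ := hφc.isCompact.isBounded.exists_pos_norm_le
  refine tendsto_const_nhds.congr' ?_
  filter_upwards [Ioo_mem_nhdsGT (show 0 < ‖F a‖ / 2 / R by positivity)] with ε hε
  symm
  refine integral_eq_zero_of_ae (.of_forall fun x => ?_)
  by_cases hx : x ∈ tsupport g
  · have h1 : φ (ε⁻¹ • F x) = 0 := by
      refine image_eq_zero_of_notMem_tsupport fun h0 => ?_
      have h2 := hR _ h0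
      have h3 : ‖F a‖ / 2 < ‖F x‖ := (hg hx).2
      have h4 : ε * R < ‖F a‖ / 2 := (lt_div_iff₀ hR0).1 hε.2
      rw [norm_smul, norm_inv, Real.norm_of_nonneg hε.1.le, inv_mul_le_iff₀ hε.1] at h2
      linarith
    simp [h1]
  · simp [image_eq_zero_of_notMem_tsupport hx]

omit [NormedSpace ℝ E] [FiniteDimensional ℝ E] [FiniteDimensional ℝ G] [BorelSpace G] in
theorem IsLerayLimit.sum {ι : Type*} (s : Finset ι) {μ : Measure E} [IsFiniteMeasureOnCompacts μ]
    {ν : Measure G} {U : Set E} (hU : IsOpen U) {F : E → G} (hF : ContinuousOn F U)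
    {g : ι → E → ℝ} {L : ι → ℝ} (hg : ∀ i ∈ s, Continuous (g i))
    (hgc : ∀ i ∈ s, HasCompactSupport (g i)) (hgU : ∀ i ∈ s, tsupport (g i) ⊆ U)
    (h : ∀ i ∈ s, IsLerayLimit μ ν U F (g i) (L i)) :
    IsLerayLimit μ ν U F (fun x => ∑ i ∈ s, g i x) (∑ i ∈ s, L i) := by
  intro φ hφ hφc hφ0 hφ1
  refine (tendsto_finsetSum s fun i hi => h i hi φ hφ hφc hφ0 hφ1).congr fun ε => ?_
  simp only [Finset.sum_mul]
  refine (integral_finsetSum s fun i hi => ?_).symm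
  have hc : HasCompactSupport fun x => g i x * ((ε ^ finrank ℝ G)⁻¹ * φ (ε⁻¹ • F x)) :=
    (hgc i hi).mul_right
  refine (Continuous.integrable_of_hasCompactSupport ?_ hc).integrableOn
  refine ContinuousOn.continuous_of_tsupport_subset (s := U) ?_ hU
    ((tsupport_mul_subset_left).trans (hgU i hi))
  exact (hg i hi).continuousOn.mul (continuousOn_const.mul
    (hφ.comp_continuousOn (continuousOn_const.smul hF)))

theorem exists_isLerayLimit (μ : Measure E) [μ.IsAddHaarMeasure] (ν : Measure G)
    [ν.IsAddHaarMeasure] {U : Set E} (hU : IsOpen U) {F : E → G} (hF : ContDiffOn ℝ 1 F U)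
    (hreg : ∀ x ∈ U, F x = 0 → Function.Surjective (fderiv ℝ F x)) {f : E → ℝ}
    (hf : Continuous f) (hfc : HasCompactSupport f) (hfU : tsupport f ⊆ U) :
    ∃ L, IsLerayLimit μ ν U F f L := by
  have hloc : ∀ a : U, ∃ V, IsOpen V ∧ (a : E) ∈ V ∧ V ⊆ U ∧ ∀ g : E → ℝ, Continuous g →
      HasCompactSupport g → tsupport g ⊆ V → ∃ L, IsLerayLimit μ ν U F g L := by
    rintro ⟨a, ha⟩
    by_cases hFa : F a = 0
    · exact exists_isOpen_isLerayLimit_of_eq_zero μ ν hU hF ha (hreg a ha hFa)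
    · obtain ⟨V, hV, haV, hVU, h⟩ :=
        exists_isOpen_isLerayLimit_of_ne_zero μ ν hU hF.continuousOn ha hFa
      exact ⟨V, hV, haV, hVU, fun g _ _ hg => ⟨0, h g hg⟩⟩
  choose V hV hmem hVU hlim using hloc
  obtain ⟨t, ht⟩ := hfc.isCompact.elim_finite_subcover V hV fun x hx =>
    mem_iUnion.2 ⟨⟨x, hfU hx⟩, hmem _⟩
  let W : Fin t.card → Set E := fun i => V (t.equivFin.symm i)
  have hW : tsupport f ⊆ ⋃ i, W i := fun x hx => by
    obtain ⟨a, hat, hxa⟩ := mem_iUnion₂.1 (ht hx)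
    exact mem_iUnion.2 ⟨t.equivFin ⟨a, hat⟩, by simpa [W] using hxa⟩
  obtain ⟨ρ, hρW, hρ1, -, -⟩ :=
    exists_continuous_sum_one_of_isOpen_isCompact (fun i => hV _) hfc.isCompact hW
  have hg : ∀ i, Continuous fun x => ρ i x * f x := fun i => (ρ i).continuous.mul hf
  have hgc : ∀ i, HasCompactSupport fun x => ρ i x * f x := fun i => hfc.mul_left
  have hgW : ∀ i, tsupport (fun x => ρ i x * f x) ⊆ W i := fun i =>
    (tsupport_mul_subset_left).trans (hρW i)
  choose L hL using fun i => hlim _ _ (hg i) (hgc i) (hgW i)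
  refine ⟨∑ i, L i, ?_⟩
  convert IsLerayLimit.sum Finset.univ hU hF.continuousOn (fun i _ => hg i) (fun i _ => hgc i)
    (fun i _ => (hgW i).trans (hVU _)) (fun i _ => hL i) using 1
  ext x
  rw [← Finset.sum_mul]
  by_cases hx : x ∈ tsupport f
  · have := hρ1 hx
    rw [Finset.sum_apply, Pi.one_apply] at this
    rw [this, one_mul]
  · simp [image_eq_zero_of_notMem_tsupport hx]

/-- **Existence and uniqueness of the Leray measure.** Let `n ≥ m ≥ 1`, `U ⊆ ℝⁿ` open,
and `F : U → ℝ^m` smooth with `0` a regular value.  For every continuous `f` with compact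
support contained in `U`, the limits `lim_{ε→0⁺} ∫_U f(x) ε^{−m} φ(F(x)/ε) dx` exist and
have a common value `L`, independent of the choice of approximate identity `φ`. -/
theorem leray_measure_exists (n m : ℕ) (hm : 1 ≤ m) (hmn : m ≤ n)
    (U : Set (EuclideanSpace ℝ (Fin n))) (hU : IsOpen U)
    (F : EuclideanSpace ℝ (Fin n) → EuclideanSpace ℝ (Fin m))
    (hF : ContDiffOn ℝ (⊤ : ℕ∞) F U)
    (hreg : ∀ x ∈ U, F x = 0 → Function.Surjective (fderiv ℝ F x))
    (f : EuclideanSpace ℝ (Fin n) → ℝ) (hf : Continuous f) (hfc : HasCompactSupport f)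
    (hsupp : tsupport f ⊆ U) :
    ∃ L : ℝ, ∀ φ : EuclideanSpace ℝ (Fin m) → ℝ,
      Continuous φ → HasCompactSupport φ → (∀ y, 0 ≤ φ y) → (∫ y, φ y) = 1 →
      Filter.Tendsto (fun ε : ℝ => ∫ x in U, f x * ((ε ^ m)⁻¹ * φ (ε⁻¹ • F x)))
        (nhdsWithin 0 (Set.Ioi 0)) (nhds L) := by
  simpa only [IsLerayLimit, finrank_euclideanSpace_fin] using
    exists_isLerayLimit volume volume hU (hF.of_le (by exact_mod_cast le_top)) hreg hf hfc hsupp
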